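/- Let X be a complete connected locally compact median space of finite rank, and suppose the isometry group of X acts minimally on X, i.e. for every x ∈ X the convex hull of the orbit Isom(X)·x is all of X. Then for all x₀, x ∈ X, the orbit of x under the stabilizer Stab(x₀) := {g ∈ Isom(X) | g(x₀) = x₀} is finite. -/

import Mathlib

/-- The interval `[a,b]` in a metric space: points `x` with `d(a,x) + d(x,b) = d(a,b)`. -/
def mInterval {X : Type*} [MetricSpace X] (a b : X) : Set X :=
  {x : X | dist a x + dist x b = dist a b}

/-- A median space: every triple of points has a unique median point. -/
def IsMedianSpace (X : Type*) [MetricSpace X] : Prop :=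
  ∀ a b c : X, ∃! m : X,
    m ∈ mInterval a b ∩ mInterval b c ∩ mInterval a c

/-- A subset is (median) convex if it contains the interval between any two of its points. -/
def MConvex {X : Type*} [MetricSpace X] (C : Set X) : Prop :=
  ∀ a ∈ C, ∀ b ∈ C, mInterval a b ⊆ C

/-- A halfspace: a convex subset with convex complement. -/
def IsHalfspace {X : Type*} [MetricSpace X] (h : Set X) : Prop :=
  MConvex h ∧ MConvex hᶜ

/-- Two subsets are transverse if the four pairwise intersections of them and
their complements are all nonempty. -/
def TransverseSets {X : Type*} (h₁ h₂ : Set X) : Prop :=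
  (h₁ ∩ h₂).Nonempty ∧ (h₁ᶜ ∩ h₂).Nonempty ∧ (h₁ ∩ h₂ᶜ).Nonempty ∧ (h₁ᶜ ∩ h₂ᶜ).Nonempty

/-- `X` has rank `n`: there are `n` pairwise transverse halfspaces but not `n+1`. -/
def HasMedianRank (X : Type*) [MetricSpace X] (n : ℕ) : Prop :=
  (∃ h : Fin n → Set X, (∀ i, IsHalfspace (h i)) ∧
    ∀ i j, i ≠ j → TransverseSets (h i) (h j)) ∧
  ¬ ∃ h : Fin (n + 1) → Set X, (∀ i, IsHalfspace (h i)) ∧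
    ∀ i j, i ≠ j → TransverseSets (h i) (h j)

/-- Median convex hull: intersection of all convex subsets containing `A`. -/
def mConvexHull {X : Type*} [MetricSpace X] (A : Set X) : Set X :=
  ⋂₀ {C : Set X | MConvex C ∧ A ⊆ C}

/-- The hyperplane bounding a halfspace `h`. -/
def mHyperplane {X : Type*} [MetricSpace X] (h : Set X) : Set X :=
  closure h ∩ closure hᶜ

/-- Depth of the halfspace `h` in the subset `A`:
`sup { d(x, ĥ) | x ∈ h ∩ A }`. -/
noncomputable def mDepth {X : Type*} [MetricSpace X] (A h : Set X) : ℝ :=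
  sSup ((fun x => Metric.infDist x (mHyperplane h)) '' (h ∩ A))

/-- `π` is the nearest-point projection onto `C`. -/
def IsNearestPointProj {X : Type*} [MetricSpace X] (C : Set X) (π : X → X) : Prop :=
  ∀ x : X, π x ∈ C ∧ dist x (π x) = Metric.infDist x C

/-- The halfspace `h` separates the points `x` and `y`. -/
def SeparatesPts {X : Type*} (h : Set X) (x y : X) : Prop :=
  (x ∈ h ∧ y ∈ hᶜ) ∨ (y ∈ h ∧ x ∈ hᶜ)

section Foundations

variable {X : Type*} [MetricSpace X]

lemma mI_symm {a b z : X} (h : z ∈ mInterval a b) : z ∈ mInterval b a := by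
  simp only [mInterval, Set.mem_ofPred_eq] at *
  rw [dist_comm b z, dist_comm z a, dist_comm b a]; linarith

lemma mI_left (a b : X) : a ∈ mInterval a b := by simp [mInterval]

lemma mI_right (a b : X) : b ∈ mInterval a b := by simp [mInterval]

/-- `a, y, x, b` : from `x ∈ [a,b]`, `y ∈ [a,x]` get `y ∈ [a,b]`. -/
lemma mI_t1 {a b x y : X} (hx : x ∈ mInterval a b) (hy : y ∈ mInterval a x) :
    y ∈ mInterval a b := by
  simp only [mInterval, Set.mem_ofPred_eq] at *
  linarith [dist_triangle y x b, dist_triangle a y b]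

lemma mI_t2 {a b x y : X} (hx : x ∈ mInterval a b) (hy : y ∈ mInterval a x) :
    x ∈ mInterval y b := by
  simp only [mInterval, Set.mem_ofPred_eq] at *
  linarith [dist_triangle y x b, dist_triangle a y b]

lemma mI_antisymm {a x y : X} (h1 : x ∈ mInterval a y) (h2 : y ∈ mInterval a x) : x = y := by
  simp only [mInterval, Set.mem_ofPred_eq] at *
  have : dist x y = 0 := by
    have := dist_comm x y
    linarith [dist_nonneg (x := x) (y := y)]
  exact dist_eq_zero.1 this

/-- The median of three points. -/
noncomputable def med (hmed : IsMedianSpace X) (a b c : X) : X := (hmed a b c).choose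


lemma med_ab (hmed : IsMedianSpace X) (a b c : X) : med hmed a b c ∈ mInterval a b := (hmed a b c).choose_spec.1.1.1

lemma med_bc (hmed : IsMedianSpace X) (a b c : X) : med hmed a b c ∈ mInterval b c := (hmed a b c).choose_spec.1.1.2

lemma med_ac (hmed : IsMedianSpace X) (a b c : X) : med hmed a b c ∈ mInterval a c := (hmed a b c).choose_spec.1.2

lemma med_uniq (hmed : IsMedianSpace X) {a b c m : X} (h1 : m ∈ mInterval a b) (h2 : m ∈ mInterval b c)
    (h3 : m ∈ mInterval a c) : m = med hmed a b c :=
  (hmed a b c).choose_spec.2 m ⟨⟨h1, h2⟩, h3⟩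

lemma med_of_mem (hmed : IsMedianSpace X) {a b z : X} (h : z ∈ mInterval a b) : med hmed a b z = z :=
  (med_uniq hmed h (mI_right _ _) (mI_right _ _)).symm

/-- Gate property of the median. -/
lemma med_gate (hmed : IsMedianSpace X) {x y z : X} (a : X) (hz : z ∈ mInterval x y) :
    med hmed x y a ∈ mInterval a z := by
  set u := med hmed a x z with hu
  set v := med hmed a y z with hv
  have hu1 : u ∈ mInterval a x := med_ab hmed _ _ _
  have hu2 : u ∈ mInterval x z := med_bc hmed _ _ _
  have hu3 : u ∈ mInterval a z := med_ac hmed _ _ _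
  have hv1 : v ∈ mInterval a y := med_ab hmed _ _ _
  have hv2 : v ∈ mInterval y z := med_bc hmed _ _ _
  set w := med hmed a u v with hw
  have hw1 : w ∈ mInterval a u := med_ab hmed _ _ _
  have hw2 : w ∈ mInterval u v := med_bc hmed _ _ _
  have hw3 : w ∈ mInterval a v := med_ac hmed _ _ _
  have h1 : w ∈ mInterval a x := mI_t1 hu1 hw1
  have h2 : w ∈ mInterval a y := mI_t1 hv1 hw3
  have h3 : w ∈ mInterval x y := by
    simp only [mInterval, Set.mem_ofPred_eq] at *
    have e1 := dist_triangle u z v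
    have e2 := dist_triangle x w y
    have e3 := dist_triangle x u w
    have e4 := dist_triangle w v y
    have e5 := dist_comm z v
    have e6 := dist_comm v y
    have e7 := dist_comm z y
    linarith
  have : w = med hmed x y a := med_uniq hmed h3 (mI_symm h2) (mI_symm h1)
  rw [← this]
  exact mI_t1 hu3 hw1

lemma med_lip (hmed : IsMedianSpace X) (x y a b : X) : dist (med hmed x y a) (med hmed x y b) ≤ dist a b := by
  have h1 := med_gate hmed a (med_ab hmed x y b)
  have h2 := med_gate hmed b (med_ab hmed x y a)
  simp only [mInterval, Set.mem_ofPred_eq] at h1 h2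
  have := dist_comm (med hmed x y a) (med hmed x y b)
  linarith [dist_triangle a b (med hmed x y b), dist_triangle b a (med hmed x y a), dist_comm a b]

lemma med_perm1 (hmed : IsMedianSpace X) (a b c : X) : med hmed a b c = med hmed b a c :=
  med_uniq hmed (mI_symm (med_ab hmed _ _ _)) (med_ac hmed _ _ _) (med_bc hmed _ _ _)

lemma med_perm2 (hmed : IsMedianSpace X) (a b c : X) : med hmed a b c = med hmed a c b :=
  med_uniq hmed (med_ac hmed _ _ _) (mI_symm (med_bc hmed _ _ _)) (med_ab hmed _ _ _)

lemma med_lip3 (hmed : IsMedianSpace X) (a b a' b' z : X) :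
    dist (med hmed a b z) (med hmed a' b' z) ≤ dist a a' + dist b b' := by
  have h1 : dist (med hmed a b z) (med hmed a b' z) ≤ dist b b' := by
    rw [med_perm2 hmed a b z, med_perm2 hmed a b' z]; exact med_lip hmed _ _ _ _
  have h2 : dist (med hmed a b' z) (med hmed a' b' z) ≤ dist a a' := by
    rw [med_perm1 hmed a b' z, med_perm1 hmed a' b' z, med_perm2 hmed b' a z,
      med_perm2 hmed b' a' z]; exact med_lip hmed _ _ _ _
  linarith [dist_triangle (med hmed a b z) (med hmed a b' z) (med hmed a' b' z)]

lemma mI_convex (hmed : IsMedianSpace X) (x y : X) : MConvex (mInterval x y) := by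
  intro z hz w hw t ht
  have h1 := med_gate hmed t hz
  have h2 := med_gate hmed t hw
  have h3 := med_ab hmed x y t
  set p := med hmed x y t
  have : dist p t = 0 := by
    simp only [mInterval, Set.mem_ofPred_eq] at *
    linarith [dist_triangle z p w, dist_comm z p, dist_comm z t, dist_comm t p,
      dist_nonneg (x := p) (y := t)]
  rw [← dist_eq_zero.1 this]; exact h3

/-- Shadows are convex. -/
lemma shadow_convex (hmed : IsMedianSpace X) (w z : X) : MConvex {p | w ∈ mInterval p z} := by
  intro a ha b hb v hv
  simp only [Set.mem_ofPred_eq] at *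
  set e := med hmed a b w with he
  have e1 : e ∈ mInterval a b := med_ab hmed _ _ _
  have e2 : e ∈ mInterval b w := med_bc hmed _ _ _
  have e3 : e ∈ mInterval a w := med_ac hmed _ _ _
  have : e = med hmed a b z := med_uniq hmed e1 (mI_t1 hb e2) (mI_t1 ha e3)
  have h1 : w ∈ mInterval e z := mI_t2 ha e3
  have h2 : e ∈ mInterval z v := by rw [this]; exact med_gate hmed z hv
  exact mI_symm (mI_t1 h2 (mI_symm h1))

/-- Projections onto intervals preserve betweenness. -/
lemma proj_mono (hmed : IsMedianSpace X) (x y : X) {a b z : X} (hz : z ∈ mInterval a b) :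
    med hmed x y z ∈ mInterval (med hmed x y a) (med hmed x y b) := by
  have ga := fun c (hc : c ∈ mInterval x y) => med_gate hmed a hc
  have gb := fun c (hc : c ∈ mInterval x y) => med_gate hmed b hc
  have gz := fun c (hc : c ∈ mInterval x y) => med_gate hmed z hc
  have ma := med_ab hmed x y a
  have mb := med_ab hmed x y b
  have mz := med_ab hmed x y z
  set a' := med hmed x y a
  set b' := med hmed x y b
  set z' := med hmed x y z
  set w := med hmed a' b' z' with hw
  have hwC : w ∈ mInterval x y := mI_convex hmed x y a' ma b' mb (med_ab hmed _ _ _)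
  have h1 : w ∈ mInterval a z' :=
    mI_symm (mI_t1 (mI_symm (ga z' mz)) (mI_symm (med_ac hmed a' b' z')))
  have h2 : w ∈ mInterval b z' :=
    mI_symm (mI_t1 (mI_symm (gb z' mz)) (mI_symm (med_bc hmed a' b' z')))
  have h3 : w ∈ mInterval z z' := shadow_convex hmed w z' a h1 b h2 hz
  have h4 : z' ∈ mInterval z w := gz w hwC
  rw [← mI_antisymm h3 h4]
  exact med_ab hmed _ _ _

/-- The join of a convex set and a point. -/
lemma join_convex (hmed : IsMedianSpace X) {C : Set X} (hC : MConvex C) (b : X) :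
    MConvex {z | ∃ c ∈ C, z ∈ mInterval c b} := by
  rintro z1 ⟨c1, hc1, hz1⟩ z2 ⟨c2, hc2, hz2⟩ t ht
  refine ⟨med hmed c1 c2 t, hC c1 hc1 c2 hc2 (med_ab hmed _ _ _), ?_⟩
  -- projection to `[t,b]`
  have key : ∀ c z, z ∈ mInterval c b →
      med hmed t b c ∈ mInterval t (med hmed t b z) := by
    intro c z hz
    have h := proj_mono hmed t b hz
    rw [med_of_mem hmed (mI_right t b)] at h
    exact mI_symm (mI_t2 (mI_symm (med_ab hmed t b c)) (mI_symm h))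
  have k1 := key c1 z1 hz1
  have k2 := key c2 z2 hz2
  have k3 := proj_mono hmed t b ht
  rw [med_of_mem hmed (mI_left t b)] at k3
  have k4 : t ∈ mInterval (med hmed t b c1) (med hmed t b c2) := by
    have := mI_t2 k3 (mI_symm k1)
    exact mI_symm (mI_t2 (mI_symm this) (mI_symm k2))
  have k5 := proj_mono hmed t b (med_ab hmed c1 c2 t)
  -- `t ∈ [c1', c2']`, `c = m(c1,c2,t)`; its projection is `t`
  have k6 := proj_mono hmed t b (med_bc hmed c1 c2 t)
  have k7 := proj_mono hmed t b (med_ac hmed c1 c2 t)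
  rw [med_of_mem hmed (mI_left t b)] at k6 k7
  set s := med hmed t b (med hmed c1 c2 t) with hs
  have e1 : s = t := by
    have : dist s t = 0 := by
      simp only [mInterval, Set.mem_ofPred_eq] at k4 k5 k6 k7
      have q1 := dist_comm t s
      have q2 := dist_comm t (med hmed t b c2)
      have q3 := dist_comm s (med hmed t b c2)
      linarith [dist_nonneg (x := s) (y := t)]
    exact dist_eq_zero.1 this
  have := med_bc hmed t b (med hmed c1 c2 t)
  rw [← hs, e1] at this
  exact mI_symm this

lemma pasch (hmed : IsMedianSpace X) {a b a' b' p : X} (h1 : b ∈ mInterval a p) (h2 : a' ∈ mInterval b' p) :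
    (mInterval a a' ∩ mInterval b b').Nonempty := by
  set s := med hmed a b b'
  have hs1 : s ∈ mInterval a b := med_ab hmed _ _ _
  refine ⟨s, ?_, med_bc hmed _ _ _⟩
  have := shadow_convex hmed s a b' (mI_symm (med_ac hmed a b b')) p (mI_symm (mI_t1 h1 hs1)) h2
  exact mI_symm this

lemma exists_maximal_convex {A B : Set X} (hA : MConvex A) (hAB : Disjoint A B) :
    ∃ M, A ⊆ M ∧ Maximal (fun S => MConvex S ∧ Disjoint S B) M := by
  apply zorn_subset_nonempty {S | MConvex S ∧ Disjoint S B}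
  · intro c hc hchain hne
    refine ⟨⋃₀ c, ⟨?_, ?_⟩, fun s hs => Set.subset_sUnion_of_mem hs⟩
    · rintro x ⟨s, hs, hx⟩ y ⟨t, ht, hy⟩
      rcases hchain.total hs ht with h | h
      · exact ((hc ht).1 x (h hx) y hy).trans (Set.subset_sUnion_of_mem ht)
      · exact ((hc hs).1 x hx y (h hy)).trans (Set.subset_sUnion_of_mem hs)
    · rw [Set.disjoint_sUnion_left]
      exact fun s hs => (hc hs).2
  · exact ⟨hA, hAB⟩

/-- Separation of disjoint nonempty convex sets by halfspaces. -/
lemma exists_halfspace (hmed : IsMedianSpace X) {A B : Set X} (hA : MConvex A) (hB : MConvex B)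
    (hAne : A.Nonempty) (hBne : B.Nonempty) (hAB : Disjoint A B) :
    ∃ h, IsHalfspace h ∧ A ⊆ h ∧ B ⊆ hᶜ := by
  obtain ⟨M, hAM, hM⟩ := exists_maximal_convex hA hAB
  obtain ⟨N, hBN, hN⟩ := exists_maximal_convex hB hM.1.2.symm
  have hcov : ∀ p, p ∈ M ∨ p ∈ N := by
    intro p
    by_contra hp
    push Not at hp
    have ext : ∀ (S T : Set X), S.Nonempty → Maximal (fun S => MConvex S ∧ Disjoint S T) S →
        p ∉ S → ∃ s ∈ S, ∃ t ∈ T, t ∈ mInterval s p := by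
      intro S T hS hmax hpS
      by_contra hcon
      push Not at hcon
      have hsub : S ⊆ {z | ∃ c ∈ S, z ∈ mInterval c p} := fun s hs => ⟨s, hs, mI_left _ _⟩
      have := hmax.2 (y := {z | ∃ c ∈ S, z ∈ mInterval c p})
        ⟨join_convex hmed hmax.1.1 p, by
          rw [Set.disjoint_left]
          rintro z ⟨c, hc, hz⟩ hzT
          exact hcon c hc z hzT hz⟩ hsub
      obtain ⟨s, hs⟩ := hS
      exact hpS (this ⟨s, hs, mI_right _ _⟩)
    obtain ⟨a, ha, b, hb, hab⟩ := ext M B (hAne.mono hAM) hM hp.1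
    obtain ⟨b', hb', a', ha', hab'⟩ := ext N M (hBne.mono hBN) hN hp.2
    obtain ⟨s, hs1, hs2⟩ := pasch hmed hab hab'
    exact Set.disjoint_left.1 hN.1.2 (hN.1.1 b (hBN hb) b' hb' hs2) (hM.1.1 a ha a' ha' hs1)
  have hc : Mᶜ = N := by
    ext p
    constructor
    · intro hp; exact (hcov p).resolve_left hp
    · intro hp hpM; exact Set.disjoint_left.1 hN.1.2 hp hpM
  exact ⟨M, ⟨hM.1.1, hc ▸ hN.1.1⟩, hAM, hc ▸ hBN⟩

lemma closure_convex (hmed : IsMedianSpace X) {C : Set X} (hC : MConvex C) : MConvex (closure C) := by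
  intro a ha b hb z hz
  rw [Metric.mem_closure_iff] at *
  intro ε hε
  obtain ⟨a', ha', h1⟩ := ha (ε/2) (by linarith)
  obtain ⟨b', hb', h2⟩ := hb (ε/2) (by linarith)
  refine ⟨med hmed a' b' z, hC a' ha' b' hb' (med_ab hmed _ _ _), ?_⟩
  have := med_lip3 hmed a b a' b' z
  rw [med_of_mem hmed hz] at this
  linarith

/-- Helly's theorem. -/
lemma helly (hmed : IsMedianSpace X) (hne : Nonempty X) {ι : Type*} (s : Finset ι) :
    ∀ (C : ι → Set X), (∀ i ∈ s, MConvex (C i)) →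
    (∀ i ∈ s, ∀ j ∈ s, (C i ∩ C j).Nonempty) → ∃ p, ∀ i ∈ s, p ∈ C i := by
  classical
  induction s using Finset.induction_on with
  | empty => intro C _ _; exact ⟨Classical.choice hne, by simp⟩
  | insert i s hi ih =>
    intro C hC hp
    by_cases hs : s.Nonempty
    · have c1 : ∀ j ∈ s, MConvex (C i ∩ C j) := by
        intro j hj a ha b hb z hz
        exact ⟨hC i (by simp) a ha.1 b hb.1 hz, hC j (by simp [hj]) a ha.2 b hb.2 hz⟩
      have c2 : ∀ j ∈ s, ∀ k ∈ s, ((C i ∩ C j) ∩ (C i ∩ C k)).Nonempty := by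
        intro j hj k hk
        obtain ⟨a, ha⟩ := hp i (by simp) j (by simp [hj])
        obtain ⟨b, hb⟩ := hp i (by simp) k (by simp [hk])
        obtain ⟨c, hc⟩ := hp j (by simp [hj]) k (by simp [hk])
        refine ⟨med hmed a b c, ⟨?_, ?_⟩, ⟨?_, ?_⟩⟩
        · exact hC i (by simp) a ha.1 b hb.1 (med_ab hmed _ _ _)
        · exact hC j (by simp [hj]) a ha.2 c hc.1 (med_ac hmed _ _ _)
        · exact hC i (by simp) a ha.1 b hb.1 (med_ab hmed _ _ _)
        · exact hC k (by simp [hk]) b hb.2 c hc.2 (med_bc hmed _ _ _)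
      obtain ⟨p, hpp⟩ := ih (fun j => C i ∩ C j) c1 c2
      refine ⟨p, ?_⟩
      intro j hj
      rw [Finset.mem_insert] at hj
      rcases hj with rfl | hj
      · obtain ⟨k, hk⟩ := hs
        exact (hpp k hk).1
      · exact (hpp j hj).2
    · rw [Finset.not_nonempty_iff_eq_empty] at hs
      subst hs
      obtain ⟨p, hp⟩ := hp i (by simp) i (by simp)
      exact ⟨p, by simpa using hp.1⟩

lemma mI_preconnected (hmed : IsMedianSpace X) [ConnectedSpace X] (a b : X) : IsPreconnected (mInterval a b) := by
  have : mInterval a b = (fun z => med hmed a b z) '' Set.univ := by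
    ext z
    constructor
    · intro hz; exact ⟨z, trivial, med_of_mem hmed hz⟩
    · rintro ⟨w, _, rfl⟩; exact med_ab hmed _ _ _
  rw [this]
  apply isPreconnected_univ.image
  apply Continuous.continuousOn
  exact (LipschitzWith.of_dist_le_mul (K := 1) (fun x y => by simpa using med_lip hmed a b x y)).continuous

lemma mI_exists_between (hmed : IsMedianSpace X) [ConnectedSpace X] (a b : X) {t : ℝ} (h0 : 0 ≤ t) (h1 : t ≤ dist a b) :
    ∃ z ∈ mInterval a b, dist a z = t := by
  have hc : ContinuousOn (fun z => dist a z) (mInterval a b) := by fun_prop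
  have := (mI_preconnected hmed a b).intermediate_value (mI_left a b) (mI_right a b) hc
  simp only [dist_self] at this
  exact this ⟨h0, h1⟩

end Foundations
section Hulls

variable {X : Type*} [MetricSpace X]

lemma hull_convex (A : Set X) : MConvex (mConvexHull A) := by
  intro a ha b hb z hz C hC
  exact hC.1 a (ha C hC) b (hb C hC) hz

lemma subset_hull (A : Set X) : A ⊆ mConvexHull A := fun a ha C hC => hC.2 ha

lemma hull_min {A C : Set X} (hC : MConvex C) (h : A ⊆ C) : mConvexHull A ⊆ C :=
  fun z hz => hz C ⟨hC, h⟩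

lemma hull_mono {A B : Set X} (h : A ⊆ B) : mConvexHull A ⊆ mConvexHull B :=
  hull_min (hull_convex B) (h.trans (subset_hull B))

lemma singleton_convex (a : X) : MConvex ({a} : Set X) := by
  intro x hx y hy z hz
  rw [Set.mem_singleton_iff] at hx hy
  rw [hx, hy] at hz
  simp only [mInterval, Set.mem_ofPred_eq, dist_self] at hz
  have : dist a z = 0 := by
    linarith [dist_nonneg (x := a) (y := z), dist_nonneg (x := z) (y := a)]
  exact (dist_eq_zero.1 this).symm

/-- No `n+1` pairwise transverse halfspaces. -/
def RankLE (X : Type*) [MetricSpace X] (n : ℕ) : Prop :=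
  ¬ ∃ h : Fin (n + 1) → Set X, (∀ i, IsHalfspace (h i)) ∧
    ∀ i j, i ≠ j → TransverseSets (h i) (h j)

lemma hull_finite_char {A : Set X} {z : X} (hz : z ∈ mConvexHull A) :
    ∃ T : Finset X, (T : Set X) ⊆ A ∧ z ∈ mConvexHull (T : Set X) := by
  classical
  refine hull_min (C := {z | ∃ T : Finset X, (T : Set X) ⊆ A ∧ z ∈ mConvexHull (T : Set X)})
    ?_ ?_ hz
  · rintro a ⟨T, hT, ha⟩ b ⟨S, hS, hb⟩ w hw
    refine ⟨T ∪ S, by simp [hT, hS], ?_⟩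
    exact hull_convex _ a (hull_mono (by simp) ha) b (hull_mono (by simp) hb) hw
  · intro a ha
    exact ⟨{a}, by simpa using ha, subset_hull _ (by simp)⟩


/-- Caratheodory's theorem. -/
lemma caratheodory (hmed : IsMedianSpace X) {n : ℕ} (hn : RankLE X n) {A : Set X} {z : X} (hz : z ∈ mConvexHull A) :
    ∃ T : Finset X, (T : Set X) ⊆ A ∧ T.card ≤ n + 2 ∧ z ∈ mConvexHull (T : Set X) := by
  classical
  have hex : ∃ k, ∃ T : Finset X, (T : Set X) ⊆ A ∧ T.card = k ∧ z ∈ mConvexHull (T : Set X) := by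
    obtain ⟨T, h1, h2⟩ := hull_finite_char hz
    exact ⟨_, T, h1, rfl, h2⟩
  obtain ⟨T, h1, h2, h3⟩ := Nat.find_spec hex
  refine ⟨T, h1, ?_, h3⟩
  by_contra hcard
  push Not at hcard
  have hsep : ∀ t ∈ T, ∃ h, IsHalfspace h ∧ (∀ s ∈ T, s ≠ t → s ∈ h) ∧ t ∉ h ∧ z ∉ h := by
    intro t ht
    have hnot : z ∉ mConvexHull ((T.erase t : Finset X) : Set X) := by
      intro hz'
      refine Nat.find_min hex (m := (T.erase t).card) ?_ ⟨T.erase t, ?_, rfl, hz'⟩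
      · rw [← h2]; exact Finset.card_erase_lt_of_mem ht
      · exact (Finset.coe_subset.2 (Finset.erase_subset _ _)).trans h1
    have hne : (T.erase t).Nonempty := by
      rw [← Finset.card_pos, Finset.card_erase_of_mem ht]; omega
    obtain ⟨h, hh, hA, hB⟩ := exists_halfspace hmed (hull_convex ((T.erase t : Finset X) : Set X))
      (singleton_convex z) ((Finset.coe_nonempty.2 hne).mono (subset_hull _)) ⟨z, rfl⟩
      (Set.disjoint_singleton_right.2 hnot)
    have hs : ∀ s ∈ T, s ≠ t → s ∈ h := fun s hs hst =>
      hA (subset_hull _ (by simp [hs, hst]))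
    have hzh : z ∉ h := hB rfl
    refine ⟨h, hh, hs, ?_, hzh⟩
    intro hth
    apply hzh
    refine hull_min hh.1 ?_ h3
    intro s hsT
    by_cases hst : s = t
    · rw [hst]; exact hth
    · exact hs s hsT hst
  choose! H hH1 hH2 hH3 hH4 using hsep
  obtain ⟨e⟩ : Nonempty (Fin (n + 1) ↪ T) := by
    apply Function.Embedding.nonempty_of_card_le
    simp; omega
  apply hn
  refine ⟨fun i => H (e i), fun i => hH1 _ (e i).2, ?_⟩
  intro i j hij
  have hne : (e i : X) ≠ e j := fun h => hij (e.injective (Subtype.ext h))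
  obtain ⟨s, hs⟩ : ((T.erase (e i)).erase (e j)).Nonempty := by
    rw [← Finset.card_pos, Finset.card_erase_of_mem (by simp [hne.symm]),
      Finset.card_erase_of_mem (e i).2]; omega
  simp only [Finset.mem_erase] at hs
  exact ⟨⟨s, hH2 _ (e i).2 s hs.2.2 hs.2.1, hH2 _ (e j).2 s hs.2.2 hs.1⟩,
    ⟨e i, hH3 _ (e i).2, hH2 _ (e j).2 _ (e i).2 hne⟩,
    ⟨e j, hH2 _ (e i).2 _ (e j).2 hne.symm, hH3 _ (e j).2⟩,
    ⟨z, hH4 _ (e i).2, hH4 _ (e j).2⟩⟩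

lemma hull_insert (hmed : IsMedianSpace X) {T : Set X} (hT : T.Nonempty) (t : X) :
    mConvexHull (insert t T) ⊆ {z | ∃ c ∈ mConvexHull T, z ∈ mInterval c t} := by
  apply hull_min (join_convex hmed (hull_convex T) t)
  intro s hs
  rcases hs with rfl | hs
  · obtain ⟨u, hu⟩ := hT
    exact ⟨u, subset_hull _ hu, mI_right _ _⟩
  · exact ⟨s, subset_hull _ hs, mI_left _ _⟩

lemma infDist_interval (hmed : IsMedianSpace X) {C : Set X} (hC : MConvex C) (hne : C.Nonempty) {a b z : X}
    (hz : z ∈ mInterval a b) :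
    Metric.infDist z C ≤ Metric.infDist a C + Metric.infDist b C := by
  apply le_of_forall_pos_le_add
  intro ε hε
  obtain ⟨a', ha', h1⟩ := (Metric.infDist_lt_iff hne (x := a) (r := Metric.infDist a C + ε/2)).1
    (by linarith)
  obtain ⟨b', hb', h2⟩ := (Metric.infDist_lt_iff hne (x := b) (r := Metric.infDist b C + ε/2)).1
    (by linarith)
  have h3 := med_lip3 hmed a b a' b' z
  rw [med_of_mem hmed hz] at h3
  have h4 := Metric.infDist_le_dist_of_mem (x := z)
    (hC a' ha' b' hb' (med_ab hmed a' b' z))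
  linarith

lemma infDist_hull (hmed : IsMedianSpace X) {C : Set X} (hC : MConvex C) (hne : C.Nonempty) {r : ℝ} (T : Finset X)
    (hTne : T.Nonempty) : (∀ t ∈ T, Metric.infDist t C ≤ r) →
    ∀ z ∈ mConvexHull (T : Set X), Metric.infDist z C ≤ T.card * r := by
  classical
  induction hTne using Finset.Nonempty.cons_induction with
  | singleton a =>
    intro hT z hz
    have : z = a := hull_min (singleton_convex a) (by simp) hz
    subst this
    simpa using hT z (by simp)
  | cons a s ha hs ih =>
    intro hT z hz
    rw [Finset.coe_cons] at hz
    obtain ⟨c, hc, hzc⟩ := hull_insert hmed (Finset.coe_nonempty.2 hs) a hz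
    have h1 := ih (fun t ht => hT t (by simp [ht])) c hc
    have h2 := hT a (by simp)
    have h3 := infDist_interval hmed hC hne hzc
    rw [Finset.card_cons]
    push_cast
    linarith

/-- Thick separation. -/
lemma thick_sep (hmed : IsMedianSpace X) {n : ℕ} (hn : RankLE X n) {ρ : ℝ} (hρ : 0 < ρ) :
    ∃ η > 0, ∀ A B : Set X, MConvex A → MConvex B → A.Nonempty → B.Nonempty →
      (∀ a ∈ A, ∀ b ∈ B, ρ ≤ dist a b) →
      ∃ h, IsHalfspace h ∧ (∀ a ∈ A, Metric.ball a η ⊆ h) ∧ ∀ b ∈ B, Metric.ball b η ⊆ hᶜ := by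
  have hN : (0 : ℝ) < n + 2 := by positivity
  set η : ℝ := ρ / (4 * (n + 2)) with hη
  have hηpos : 0 < η := by positivity
  refine ⟨η, hηpos, ?_⟩
  intro A B hA hB hAne hBne hAB
  have key : ∀ C : Set X, MConvex C → C.Nonempty →
      ∀ z ∈ mConvexHull (Metric.thickening η C), Metric.infDist z C ≤ ρ / 4 := by
    intro C hC hne z hz
    obtain ⟨T, h1, h2, h3⟩ := caratheodory hmed hn hz
    have hTne : T.Nonempty := by
      by_contra hT
      rw [Finset.not_nonempty_iff_eq_empty] at hT
      subst hT
      exact hull_min (C := ∅) (fun a ha => ha.elim) (by simp) h3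
    have h4 := infDist_hull hmed hC hne T hTne (r := η) (fun t ht => by
      obtain ⟨c, hc, hd⟩ := Metric.mem_thickening_iff.1 (h1 ht)
      exact (Metric.infDist_le_dist_of_mem hc).trans hd.le) z h3
    have h5 : (T.card : ℝ) ≤ n + 2 := by exact_mod_cast h2
    calc Metric.infDist z C ≤ T.card * η := h4
      _ ≤ (n + 2) * η := by gcongr
      _ = ρ / 4 := by rw [hη]; field_simp
  obtain ⟨h, hh, h1, h2⟩ := exists_halfspace hmed (hull_convex (Metric.thickening η A))
    (hull_convex (Metric.thickening η B))
    ((hAne.mono (Metric.self_subset_thickening hηpos A)).mono (subset_hull _))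
    ((hBne.mono (Metric.self_subset_thickening hηpos B)).mono (subset_hull _)) (by
      rw [Set.disjoint_left]
      intro z hzA hzB
      obtain ⟨a, ha, h1⟩ := (Metric.infDist_lt_iff hAne (x := z) (r := ρ / 2)).1
        ((key A hA hAne z hzA).trans_lt (by linarith))
      obtain ⟨b, hb, h2⟩ := (Metric.infDist_lt_iff hBne (x := z) (r := ρ / 2)).1
        ((key B hB hBne z hzB).trans_lt (by linarith))
      have := hAB a ha b hb
      linarith [dist_triangle a z b, dist_comm a z])
  exact ⟨h, hh, fun a ha => ((Metric.ball_subset_thickening ha η).trans (subset_hull _)).trans h1,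
    fun b hb => ((Metric.ball_subset_thickening hb η).trans (subset_hull _)).trans h2⟩

lemma hull_compact (hmed : IsMedianSpace X) [ProperSpace X] (T : Finset X) : IsCompact (mConvexHull (T : Set X)) := by
  classical
  induction T using Finset.induction_on with
  | empty =>
    have : mConvexHull ((∅ : Finset X) : Set X) = ∅ :=
      Set.subset_empty_iff.1 (hull_min (C := ∅) (fun a ha => ha.elim) (by simp))
    rw [this]; exact isCompact_empty
  | insert t T ht ih =>
    by_cases hT : T.Nonempty
    · obtain ⟨R, hR⟩ := ih.isBounded.subset_closedBall t
      have hcl : IsClosed {q : X × X | q.2 ∈ mInterval q.1 t} := by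
        simp only [mInterval, Set.mem_ofPred_eq]
        exact isClosed_eq (by fun_prop) (by fun_prop)
      have hcomp := ((ih.prod (isCompact_closedBall t R)).inter_right hcl).image continuous_snd
      convert hcomp using 1
      apply subset_antisymm
      · intro z hz
        rw [Finset.coe_insert] at hz
        obtain ⟨c, hc, hzc⟩ := hull_insert hmed (Finset.coe_nonempty.2 hT) t hz
        refine ⟨(c, z), ⟨⟨hc, ?_⟩, hzc⟩, rfl⟩
        have := hR hc
        simp only [Metric.mem_closedBall] at this ⊢
        simp only [mInterval, Set.mem_ofPred_eq] at hzc
        linarith [dist_nonneg (x := c) (y := z)]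
      · rintro z ⟨⟨c, w⟩, ⟨⟨hc, _⟩, hw⟩, rfl⟩
        rw [Finset.coe_insert]
        exact hull_convex _ c (hull_mono (Set.subset_insert _ _) hc) t
          (subset_hull _ (Set.mem_insert _ _)) hw
    · rw [Finset.not_nonempty_iff_eq_empty] at hT
      subst hT
      have : mConvexHull ((insert t ∅ : Finset X) : Set X) = {t} := by
        apply subset_antisymm
        · exact hull_min (singleton_convex t) (by simp)
        · intro z hz; exact subset_hull _ (by simpa using hz)
      rw [this]; exact isCompact_singleton

/-- Hopf-Rinow. -/
lemma median_proper (hmed : IsMedianSpace X) [CompleteSpace X] [ConnectedSpace X] [LocallyCompactSpace X] :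
    ProperSpace X := by
  have step : ∀ (x : X) (r δ : ℝ), 0 ≤ r → 0 ≤ δ → ∀ z ∈ Metric.closedBall x (r + δ),
      ∃ y ∈ Metric.closedBall x r, dist z y ≤ δ := by
    intro x r δ hr hδ z hz
    by_cases h : dist x z ≤ r
    · exact ⟨z, by simpa [dist_comm] using h, by simpa using hδ⟩
    · push Not at h
      obtain ⟨y, hy, hyr⟩ := mI_exists_between hmed x z hr h.le
      refine ⟨y, by simp [dist_comm y x, hyr], ?_⟩
      simp only [Metric.mem_closedBall, mInterval, Set.mem_ofPred_eq] at hz hy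
      linarith [dist_comm z x, dist_comm z y]
  refine ⟨fun x => ?_⟩
  have hdown : ∀ r s : ℝ, s ≤ r → IsCompact (Metric.closedBall x r) →
      IsCompact (Metric.closedBall x s) := fun r s hs h =>
    h.of_isClosed_subset Metric.isClosed_closedBall (Metric.closedBall_subset_closedBall hs)
  by_contra hcon
  push Not at hcon
  obtain ⟨r₀, hr₀⟩ := hcon
  set S := {r : ℝ | IsCompact (Metric.closedBall x r)} with hS
  have hbdd : BddAbove S := ⟨r₀, fun r hr => by
    by_contra h
    push Not at h
    exact hr₀ (hdown r r₀ h.le hr)⟩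
  have h0 : (0 : ℝ) ∈ S := by simp [hS]
  set s := sSup S with hs
  have hs0 : 0 ≤ s := le_csSup hbdd h0
  have hlt : ∀ t < s, IsCompact (Metric.closedBall x t) := by
    intro t ht
    obtain ⟨r, hr, htr⟩ := exists_lt_of_lt_csSup ⟨0, h0⟩ ht
    exact hdown r t htr.le hr
  have hsS : IsCompact (Metric.closedBall x s) := by
    rcases hs0.eq_or_lt with h | hspos
    · rw [← h]; exact h0
    refine TotallyBounded.isCompact_of_isClosed ?_ Metric.isClosed_closedBall
    rw [Metric.totallyBounded_iff]
    intro ε hε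
    set δ := min (ε / 2) s with hδ
    have hδ0 : 0 < δ := lt_min (by linarith) hspos
    have hδs : δ ≤ s := min_le_right _ _
    have hδε : δ ≤ ε / 2 := min_le_left _ _
    obtain ⟨t, ht, hcov⟩ := Metric.totallyBounded_iff.1
      (hlt (s - δ) (by linarith)).totallyBounded (ε / 2) (by linarith)
    refine ⟨t, ht, ?_⟩
    intro z hz
    obtain ⟨y, hy, hzy⟩ := step x (s - δ) δ (by linarith) hδ0.le z (by simpa using hz)
    have := hcov hy
    simp only [Set.mem_iUnion, Metric.mem_ball] at this ⊢
    obtain ⟨q, hq, hyq⟩ := this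
    exact ⟨q, hq, by linarith [dist_triangle z y q]⟩
  obtain ⟨δ, hδ, hc⟩ := hsS.exists_isCompact_cthickening
  have : s + δ ∈ S := by
    refine hc.of_isClosed_subset Metric.isClosed_closedBall ?_
    intro z hz
    obtain ⟨y, hy, hzy⟩ := step x s δ hs0 hδ.le z hz
    exact Metric.mem_cthickening_of_dist_le z y δ _ hy hzy
  linarith [le_csSup hbdd this]

end Hulls
section Thin

variable {X : Type*} [MetricSpace X]

lemma halfspace_compl {h : Set X} (hh : IsHalfspace h) : IsHalfspace hᶜ :=
  ⟨hh.2, by rw [compl_compl]; exact hh.1⟩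

lemma isometry_mI {f : X → X} (hf : Isometry f) {a b z : X} :
    f z ∈ mInterval (f a) (f b) ↔ z ∈ mInterval a b := by
  simp only [mInterval, Set.mem_ofPred_eq, hf.dist_eq]

lemma preimage_convex {f : X → X} (hf : Isometry f) {C : Set X} (hC : MConvex C) :
    MConvex (f ⁻¹' C) := fun a ha b hb _ hz => hC (f a) ha (f b) hb ((isometry_mI hf).2 hz)

lemma preimage_halfspace {f : X → X} (hf : Isometry f) {h : Set X} (hh : IsHalfspace h) :
    IsHalfspace (f ⁻¹' h) := ⟨preimage_convex hf hh.1, preimage_convex hf hh.2⟩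

/-- `m` pairwise transverse nontrivial halfspaces. -/
def HasCube (X : Type*) [MetricSpace X] (m : ℕ) : Prop :=
  ∃ h : Fin m → Set X, (∀ i, IsHalfspace (h i)) ∧ (∀ i, (h i).Nonempty ∧ (h i)ᶜ.Nonempty) ∧
    ∀ i j, i ≠ j → TransverseSets (h i) (h j)

lemma exists_max_cube {n : ℕ} (hn : RankLE X n) : ∃ m, HasCube X m ∧ ¬ HasCube X (m + 1) := by
  classical
  have hex : ∃ m, ¬ HasCube X (m + 1) := ⟨n, fun ⟨h, h1, _, h3⟩ => hn ⟨h, h1, h3⟩⟩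
  refine ⟨Nat.find hex, ?_, Nat.find_spec hex⟩
  rcases Nat.eq_zero_or_pos (Nat.find hex) with h | h
  · rw [h]
    exact ⟨fun _ => ∅, fun i => i.elim0, fun i => i.elim0, fun i => i.elim0⟩
  · have := Nat.find_min hex (m := Nat.find hex - 1) (by omega)
    rw [not_not, Nat.sub_add_cancel h] at this
    exact this


lemma exists_corners (hmed : IsMedianSpace X) [Nonempty X] {m : ℕ} {h : Fin m → Set X} (h1 : ∀ i, IsHalfspace (h i))
    (h2 : ∀ i, (h i).Nonempty ∧ (h i)ᶜ.Nonempty)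
    (h3 : ∀ i j, i ≠ j → TransverseSets (h i) (h j)) :
    ∃ u : (Fin m → Bool) → X, ∀ e i, (e i = true → u e ∈ h i) ∧ (e i = false → u e ∈ (h i)ᶜ) := by
  classical
  have : ∀ e : Fin m → Bool, ∃ p, ∀ i ∈ (Finset.univ : Finset (Fin m)),
      p ∈ (if e i = true then h i else (h i)ᶜ) := by
    intro e
    apply helly hmed inferInstance
    · intro i _
      split_ifs
      · exact (h1 i).1
      · exact (h1 i).2
    · intro i _ j _
      by_cases hij : i = j
      · subst hij
        rw [Set.inter_self]
        split_ifs
        · exact (h2 i).1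
        · exact (h2 i).2
      · obtain ⟨t1, t2, t3, t4⟩ := h3 i j hij
        split_ifs
        · exact t1
        · exact t3
        · exact t2
        · exact t4
  choose u hu using this
  refine ⟨u, fun e i => ⟨fun he => ?_, fun he => ?_⟩⟩
  · have := hu e i (Finset.mem_univ _); rwa [if_pos he] at this
  · have := hu e i (Finset.mem_univ _); rwa [if_neg (by simp [he])] at this

/-- Thickened pairs of halfspaces. -/
lemma thick_pair (hmed : IsMedianSpace X) [ProperSpace X] {n : ℕ} (hn : RankLE X n) {k : Set X} (hk : IsHalfspace k)
    (S T : Finset X) (hS : S.Nonempty) (hT : T.Nonempty) (hSk : ∀ s ∈ S, s ∈ kᶜ)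
    (hTk : ∀ t ∈ T, t ∈ k) :
    ∃ (a b : Set X) (η : ℝ), 0 < η ∧ IsHalfspace a ∧ IsHalfspace b ∧ (∀ s ∈ S, s ∈ interior a) ∧
      (∀ t ∈ T, t ∈ interior bᶜ) ∧ ∀ x ∈ a, Metric.ball x η ⊆ b := by
  set A := mConvexHull (S : Set X) with hA
  set B := mConvexHull (T : Set X) with hB
  have hAk : A ⊆ kᶜ := hull_min hk.2 (fun s hs => hSk s hs)
  have hBk : B ⊆ k := hull_min hk.1 (fun s hs => hTk s hs)
  have hAne : A.Nonempty := (Finset.coe_nonempty.2 hS).mono (subset_hull _)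
  have hBne : B.Nonempty := (Finset.coe_nonempty.2 hT).mono (subset_hull _)
  have hdisj : Disjoint A B := Set.disjoint_left.2 fun z h1 h2 => hAk h1 (hBk h2)
  obtain ⟨ρ, hρ, hd⟩ := hdisj.exists_thickenings (hull_compact hmed S) (hull_compact hmed T).isClosed
  have hdist : ∀ a ∈ A, ∀ b ∈ B, ρ ≤ dist a b := by
    intro a ha b hb
    by_contra hlt
    push Not at hlt
    exact Set.disjoint_left.1 hd (Metric.self_subset_thickening hρ A ha)
      (Metric.mem_thickening_iff.2 ⟨b, hb, hlt⟩)
  obtain ⟨η, hη, hsep⟩ := thick_sep hmed hn hρ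
  obtain ⟨a, ha, ha1, ha2⟩ := hsep A B (hull_convex _) (hull_convex _) hAne hBne hdist
  obtain ⟨η', hη', hsep'⟩ := thick_sep hmed hn hη
  have hane : a.Nonempty := hAne.mono fun x hx => ha1 x hx (Metric.mem_ball_self hη)
  obtain ⟨b, hb, hb1, hb2⟩ := hsep' a B ha.1 (hull_convex _) hane hBne (by
    intro x hx y hy
    by_contra hlt
    push Not at hlt
    exact ha2 y hy (Metric.mem_ball.2 hlt) hx)
  refine ⟨a, b, η', hη', ha, hb, ?_, ?_, hb1⟩
  · intro s hs
    exact mem_interior_iff_mem_nhds.2 (Filter.mem_of_superset (Metric.ball_mem_nhds s hη)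
      (ha1 s (subset_hull _ hs)))
  · intro s hs
    exact mem_interior_iff_mem_nhds.2 (Filter.mem_of_superset (Metric.ball_mem_nhds s hη')
      (hb2 s (subset_hull _ hs)))

lemma exists_slab (hmed : IsMedianSpace X) [ConnectedSpace X] {a b : Set X} {η : ℝ} (hη : 0 < η)
    (hab : ∀ x ∈ a, Metric.ball x η ⊆ b) {x y : X} (hx : x ∈ a) (hy : y ∈ bᶜ) :
    ∃ z ∈ mInterval x y, z ∉ a ∧ z ∈ b := by
  by_contra hcon
  push Not at hcon
  have hpc := mI_preconnected hmed x y
  obtain ⟨z, hz, hz1, hz2⟩ := hpc (Metric.thickening η a) (Metric.thickening η bᶜ)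
    Metric.isOpen_thickening Metric.isOpen_thickening (by
      intro z hz
      by_cases hza : z ∈ a
      · exact Or.inl (Metric.self_subset_thickening hη _ hza)
      · exact Or.inr (Metric.self_subset_thickening hη _ (hcon z hz hza)))
    ⟨x, mI_left _ _, Metric.self_subset_thickening hη _ hx⟩
    ⟨y, mI_right _ _, Metric.self_subset_thickening hη _ hy⟩
  obtain ⟨p, hp, hzp⟩ := Metric.mem_thickening_iff.1 hz1
  obtain ⟨q, hq, hzq⟩ := Metric.mem_thickening_iff.1 hz2
  by_cases hza : z ∈ a
  · exact hq (hab z hza (Metric.mem_ball'.2 hzq))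
  · exact hcon z hz hza (hab p hp (Metric.mem_ball.2 hzp))

/-- A robust point: it lies in no halfspace with dense complement. -/
lemma exists_robust (hmed : IsMedianSpace X) [ProperSpace X] [ConnectedSpace X] {n : ℕ} (hn : RankLE X n) :
    ∃ p : X, ∀ h, IsHalfspace h → p ∈ h → ¬ Dense hᶜ := by
  classical
  obtain ⟨m, ⟨k, k1, k2, k3⟩, hmax⟩ := exists_max_cube hn
  obtain ⟨u, hu⟩ := exists_corners hmed k1 k2 k3
  have hpair : ∀ i, ∃ (a b : Set X) (η : ℝ), 0 < η ∧ IsHalfspace a ∧ IsHalfspace b ∧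
      (∀ e, e i = false → u e ∈ interior a) ∧
      (∀ e, e i = true → u e ∈ interior bᶜ) ∧ ∀ x ∈ a, Metric.ball x η ⊆ b := by
    intro i
    obtain ⟨a, b, η, h1, h2, h3, h4, h5, h6⟩ := thick_pair hmed hn (k1 i)
      ((Finset.univ.filter (fun e : Fin m → Bool => e i = false)).image u)
      ((Finset.univ.filter (fun e : Fin m → Bool => e i = true)).image u)
      ⟨u (fun _ => false), Finset.mem_image_of_mem _ (by simp)⟩
      ⟨u (fun _ => true), Finset.mem_image_of_mem _ (by simp)⟩
      (by
        intro s hs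
        obtain ⟨e, he, rfl⟩ := Finset.mem_image.1 hs
        exact (hu e i).2 (by simpa using he))
      (by
        intro s hs
        obtain ⟨e, he, rfl⟩ := Finset.mem_image.1 hs
        exact (hu e i).1 (by simpa using he))
    exact ⟨a, b, η, h1, h2, h3, fun e he => h4 _ (Finset.mem_image_of_mem _ (by simpa using he)),
      fun e he => h5 _ (Finset.mem_image_of_mem _ (by simpa using he)), h6⟩
  choose a b η hη ha hb hua hub hab using hpair
  have hsub : ∀ i, a i ⊆ b i := fun i x hx => hab i x hx (Metric.mem_ball_self (hη i))
  set S : Fin m → Set X := fun i => ((a i)ᶜ ∩ b i) ∩ mConvexHull (a i ∪ (b i)ᶜ) with hS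
  have hSconv : ∀ i, MConvex (S i) := by
    intro i x hx y hy z hz
    exact ⟨⟨(ha i).2 x hx.1.1 y hy.1.1 hz, (hb i).1 x hx.1.2 y hy.1.2 hz⟩,
      hull_convex _ x hx.2 y hy.2 hz⟩
  have hslab : ∀ i x y, x ∈ a i → y ∈ (b i)ᶜ → (mInterval x y ∩ S i).Nonempty := by
    intro i x y hx hy
    obtain ⟨z, hz, hz1, hz2⟩ := exists_slab hmed (hη i) (hab i) hx hy
    exact ⟨z, hz, ⟨hz1, hz2⟩, hull_convex _ x (subset_hull _ (Or.inl hx)) y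
      (subset_hull _ (Or.inr hy)) hz⟩
  have ua : ∀ e i, e i = false → u e ∈ a i := fun e i he => interior_subset (hua i e he)
  have ub : ∀ e i, e i = true → u e ∈ (b i)ᶜ := fun e i he => interior_subset (hub i e he)
  obtain ⟨p, hp⟩ : ∃ p, ∀ i ∈ (Finset.univ : Finset (Fin m)), p ∈ S i := by
    apply helly hmed inferInstance _ _ (fun i _ => hSconv i)
    intro i _ j _
    by_cases hij : i = j
    · subst hij
      obtain ⟨z, _, hz⟩ := hslab i (u fun _ => false) (u fun _ => true) (ua _ i rfl) (ub _ i rfl)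
      exact ⟨z, hz, hz⟩
    · have hup : ∀ c : Bool, Function.update (fun _ : Fin m => c) i (!c) j = c := by
        intro c; rw [Function.update_of_ne (Ne.symm hij)]
      obtain ⟨z, hz1, hz2⟩ := hslab i (u fun _ => false)
        (u (Function.update (fun _ => false) i true)) (ua _ i rfl) (ub _ i (by simp))
      obtain ⟨w, hw1, hw2⟩ := hslab i (u (Function.update (fun _ => true) i false))
        (u fun _ => true) (ua _ i (by simp)) (ub _ i rfl)
      have hza : z ∈ a j := (ha j).1 _ (ua _ j rfl) _ (ua _ j (hup false)) hz1
      have hwb : w ∈ (b j)ᶜ := (hb j).2 _ (ub _ j (hup true)) _ (ub _ j rfl) hw1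
      obtain ⟨q, hq1, hq2⟩ := hslab j z w hza hwb
      exact ⟨q, hSconv i z hz2 w hw2 hq1, hq2⟩
  refine ⟨p, fun h hh hph hdense => ?_⟩
  -- points of `hᶜ` in all corners
  have hw : ∀ e : Fin m → Bool, ∃ w, w ∈ hᶜ ∧ ∀ i, (e i = false → w ∈ a i) ∧
      (e i = true → w ∈ (b i)ᶜ) := by
    intro e
    have hopen : IsOpen (⋂ i, if e i = true then interior (b i)ᶜ else interior (a i)) := by
      apply isOpen_iInter_of_finite
      intro i
      split_ifs <;> exact isOpen_interior
    obtain ⟨w, hw1, hw2⟩ := hdense.inter_open_nonempty _ hopen ⟨u e, by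
      rw [Set.mem_iInter]
      intro i
      split_ifs with hc
      · exact hub i e hc
      · exact hua i e (by simpa using hc)⟩
    rw [Set.mem_iInter] at hw1
    refine ⟨w, hw2, fun i => ⟨fun he => ?_, fun he => ?_⟩⟩
    · have := hw1 i; rw [if_neg (by simp [he])] at this; exact interior_subset this
    · have := hw1 i; rw [if_pos he] at this; exact interior_subset this
  choose w hw1 hw2 using hw
  by_cases hall : ∀ i, ∃ c, (c = a i ∨ c = b i) ∧ (h ∩ c).Nonempty ∧ (h ∩ cᶜ).Nonempty
  · choose c hc hc1 hc2 using hall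
    have hch : ∀ i, IsHalfspace (c i) := by
      intro i; rcases hc i with h | h <;> rw [h]
      · exact ha i
      · exact hb i
    have hwc : ∀ e i, (e i = false → w e ∈ c i) ∧ (e i = true → w e ∈ (c i)ᶜ) := by
      intro e i
      rcases hc i with h | h <;> rw [h]
      · exact ⟨(hw2 e i).1, fun he hx => (hw2 e i).2 he (hsub i hx)⟩
      · exact ⟨fun he => hsub i ((hw2 e i).1 he), (hw2 e i).2⟩
    have hht : ∀ i, TransverseSets h (c i) := fun i =>
      ⟨hc1 i, ⟨w fun _ => false, hw1 _, (hwc _ i).1 rfl⟩, hc2 i,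
        ⟨w fun _ => true, hw1 _, (hwc _ i).2 rfl⟩⟩
    have hsymm : ∀ s t : Set X, TransverseSets s t → TransverseSets t s := by
      rintro s t ⟨t1, t2, t3, t4⟩
      rw [Set.inter_comm] at t1 t2 t3 t4
      exact ⟨t1, t3, t2, t4⟩
    apply hmax
    refine ⟨Fin.cons h c, ?_, ?_, ?_⟩
    · intro i
      refine Fin.cases ?_ ?_ i
      · exact hh
      · exact hch
    · intro i
      refine Fin.cases ?_ ?_ i
      · exact ⟨⟨p, hph⟩, ⟨_, hw1 fun _ => false⟩⟩
      · intro j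
        exact ⟨⟨_, (hwc (fun _ => false) j).1 rfl⟩, ⟨_, (hwc (fun _ => true) j).2 rfl⟩⟩
    · intro i j
      refine Fin.cases ?_ ?_ i <;> refine Fin.cases ?_ ?_ j
      · intro h; exact absurd rfl h
      · intro j _; exact hht j
      · intro i _; exact hsymm _ _ (hht i)
      · intro j i hij
        have hij' : i ≠ j := fun h => hij (by rw [h])
        simp only [Fin.cons_succ]
        refine ⟨⟨w fun _ => false, (hwc _ _).1 rfl, (hwc _ _).1 rfl⟩,
          ⟨w (Function.update (fun _ => false) i true), (hwc _ _).2 (by simp), (hwc _ _).1 ?_⟩,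
          ⟨w (Function.update (fun _ => true) i false), (hwc _ _).1 (by simp), (hwc _ _).2 ?_⟩,
          ⟨w fun _ => true, (hwc _ _).2 rfl, (hwc _ _).2 rfl⟩⟩
        · rw [Function.update_of_ne (Ne.symm hij')]
        · rw [Function.update_of_ne (Ne.symm hij')]
  · push Not at hall
    obtain ⟨i, hi⟩ := hall
    have hpS := hp i (Finset.mem_univ _)
    have hA := hi (a i) (Or.inl rfl)
    have hB := hi (b i) (Or.inr rfl)
    have hsub2 : a i ∪ (b i)ᶜ ⊆ hᶜ := by
      rintro x (hx | hx) hxh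
      · have : (h ∩ (a i)ᶜ) = ∅ := hA ⟨x, hxh, hx⟩
        exact Set.notMem_empty p (this ▸ ⟨hph, hpS.1.1⟩)
      · have : (h ∩ (b i)ᶜ) = ∅ := hB ⟨p, hph, hpS.1.2⟩
        exact Set.notMem_empty x (this ▸ ⟨hxh, hx⟩)
    exact hull_min hh.2 hsub2 hpS.2 hph

/-- Under minimality every nonempty halfspace has nonempty interior. -/
lemma no_thin (hmed : IsMedianSpace X) [ProperSpace X] [ConnectedSpace X] {n : ℕ} (hn : RankLE X n)
    (hmin : ∀ x : X, mConvexHull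
      {y : X | ∃ f : X → X, Isometry f ∧ Function.Surjective f ∧ f x = y} = Set.univ)
    {h : Set X} (hh : IsHalfspace h) (hne : h.Nonempty) : (interior h).Nonempty := by
  by_contra hdense
  rw [Set.not_nonempty_iff_eq_empty, interior_eq_empty_iff_dense_compl] at hdense
  obtain ⟨p, hp⟩ := exists_robust hmed hn
  have : ∃ f : X → X, Isometry f ∧ Function.Surjective f ∧ f p ∈ h := by
    by_contra hcon
    push Not at hcon
    have := hull_min hh.2 (A := {y : X | ∃ f : X → X, Isometry f ∧ Function.Surjective f ∧ f p = y})
      (by rintro y ⟨f, h1, h2, rfl⟩; exact hcon f h1 h2)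
    rw [hmin p] at this
    obtain ⟨x, hx⟩ := hne
    exact this (Set.mem_univ x) hx
  obtain ⟨f, hf, hfs, hfp⟩ := this
  refine hp (f ⁻¹' h) (preimage_halfspace hf hh) hfp ?_
  rw [← Set.preimage_compl]
  let F : X ≃ᵢ X := IsometryEquiv.mk' f (Function.surjInv hfs) (Function.surjInv_eq hfs) hf
  exact hdense.preimage F.toHomeomorph.isOpenMap

lemma transverse_of_incomparable {h k : Set X} {p q : X} (hp1 : p ∈ h) (hp2 : p ∈ k) (hq1 : q ∉ h)
    (hq2 : q ∉ k) (h1 : ¬ h ⊆ k) (h2 : ¬ k ⊆ h) : TransverseSets h k := by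
  obtain ⟨x, hx, hx'⟩ := Set.not_subset.1 h1
  obtain ⟨y, hy, hy'⟩ := Set.not_subset.1 h2
  exact ⟨⟨p, hp1, hp2⟩, ⟨y, hy', hy⟩, ⟨x, hx, hx'⟩, ⟨q, hq1, hq2⟩⟩

/-- Uniform depth, given that no halfspace is thin. -/
lemma uniform_depth {n : ℕ} (hn : RankLE X n)
    (hthin : ∀ h : Set X, IsHalfspace h → h.Nonempty → (interior h).Nonempty) (x₀ x : X) :
    ∃ ε > 0, ∃ R : ℝ, ∀ h, IsHalfspace h → x ∈ h → x₀ ∉ h →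
      ∃ p, Metric.ball p ε ⊆ h ∧ dist p x₀ ≤ R := by
  by_contra hcon
  push Not at hcon
  have hseq : ∀ i : ℕ, ∃ h, IsHalfspace h ∧ x ∈ h ∧ x₀ ∉ h ∧
      ∀ p, Metric.ball p (1 / ((i : ℝ) + 1)) ⊆ h → (i : ℝ) < dist p x₀ := fun i =>
    hcon (1 / ((i : ℝ) + 1)) (by positivity) i
  choose h hh hx hx0 hbad using hseq
  -- a common ball inside infinitely many is impossible
  have hno : ∀ g : ℕ ↪o ℕ, ∀ k : Set X, IsHalfspace k → k.Nonempty →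
      ¬ ∀ i, 0 < i → k ⊆ h (g i) := by
    intro g k hk hkne hsub
    obtain ⟨p, hp⟩ := hthin k hk hkne
    obtain ⟨δ, hδ, hball⟩ := Metric.isOpen_iff.1 isOpen_interior p hp
    obtain ⟨N1, hN1⟩ := exists_nat_one_div_lt hδ
    obtain ⟨N2, hN2⟩ := exists_nat_ge (dist p x₀)
    set i := N1 + N2 + 1
    have hgi : i ≤ g i := g.strictMono.le_apply
    have h1 : (1 : ℝ) / ((g i : ℝ) + 1) ≤ 1 / ((N1 : ℝ) + 1) := by
      apply one_div_le_one_div_of_le (by positivity)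
      have : N1 ≤ g i := by omega
      have : (N1 : ℝ) ≤ g i := by exact_mod_cast this
      linarith
    have h2 := hbad (g i) p (((Metric.ball_subset_ball (h1.trans hN1.le)).trans
      (hball.trans interior_subset)).trans (hsub i (by omega)))
    have : (N2 : ℝ) ≤ g i := by
      have : N2 ≤ g i := by omega
      exact_mod_cast this
    linarith
  obtain ⟨g, hg⟩ := exists_increasing_or_nonincreasing_subseq (· ⊆ · : Set X → Set X → Prop) h
  rcases hg with hg | hg
  · exact hno g (h (g 0)) (hh _) ⟨x, hx _⟩ (fun i hi => hg 0 i hi)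
  obtain ⟨g', hg'⟩ := exists_increasing_or_nonincreasing_subseq (· ⊇ · : Set X → Set X → Prop)
    (fun i => h (g i))
  rcases hg' with hg' | hg'
  · refine hno (g'.trans g) (⋂ i, h (g (g' i))) ⟨?_, ?_⟩ ⟨x, Set.mem_iInter.2 fun i => hx _⟩
      (fun i _ => Set.iInter_subset _ i)
    · intro a ha b hb z hz
      rw [Set.mem_iInter] at *
      exact fun i => (hh _).1 a (ha i) b (hb i) hz
    · intro a ha b hb z hz
      rw [Set.compl_iInter, Set.mem_iUnion] at *
      obtain ⟨i, hi⟩ := ha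
      obtain ⟨j, hj⟩ := hb
      have hmono : ∀ i j, i ≤ j → h (g (g' j)) ⊆ h (g (g' i)) := by
        intro i j hij
        rcases hij.eq_or_lt with rfl | hlt
        · exact subset_rfl
        · exact hg' i j hlt
      exact ⟨max i j, (hh _).2 a (fun h => hi (hmono i _ (le_max_left _ _) h)) b
        (fun h => hj (hmono j _ (le_max_right _ _) h)) hz⟩
  · apply hn
    have hinc : ∀ i j, i < j → TransverseSets (h (g (g' i))) (h (g (g' j))) := fun i j hij =>
      transverse_of_incomparable (hx _) (hx _) (hx0 _) (hx0 _)
        (hg _ _ (g'.strictMono hij)) (hg' _ _ hij)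
    have hinc2 : ∀ i j, j < i → TransverseSets (h (g (g' i))) (h (g (g' j))) := fun i j hij =>
      transverse_of_incomparable (hx _) (hx _) (hx0 _) (hx0 _)
        (hg' _ _ hij) (hg _ _ (g'.strictMono hij))
    refine ⟨fun i => h (g (g' i)), fun i => hh _, fun i j hij => ?_⟩
    rcases lt_or_gt_of_ne hij with h | h
    · exact hinc _ _ h
    · exact hinc2 _ _ h

end Thin
section Comb
open Pointwise

lemma comb {G X : Type*} [Group G] [MulAction G X] (W : Set (Set X)) (M : ℕ) (x : X)
    (hinv : ∀ (g : G), ∀ c ∈ W, g • c ∈ W)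
    (hanti : ∀ A : Finset (Set X), (∀ c ∈ A, c ∈ W) → (∀ c ∈ A, ∀ d ∈ A, c ⊆ d → c = d) →
      A.card ≤ M)
    (hrec : ∀ (g : G), ∀ c ∈ W, c ⊆ g • c → c = g • c)
    (hsep : ∀ y ∈ MulAction.orbit G x, ∀ z ∈ MulAction.orbit G x, y ≠ z →
      ∃ c ∈ W, y ∈ c ∧ z ∉ c) :
    (MulAction.orbit G x).Finite := by
  classical
  have hO : ∀ c ∈ W, ∀ S : Finset (Set X), (∀ s ∈ S, s ∈ MulAction.orbit G c) → S.card ≤ M := by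
    intro c hc S hS
    refine hanti S (fun s hs => ?_) (fun s hs t ht hst => ?_)
    · obtain ⟨g, rfl⟩ := hS s hs
      exact hinv g c hc
    · obtain ⟨a, rfl⟩ := hS s hs
      obtain ⟨b, rfl⟩ := hS t ht
      change a • c ⊆ b • c at hst
      change a • c = b • c
      have h1 : c ⊆ (a⁻¹ * b) • c := by
        rw [mul_smul]
        rw [Set.smul_set_subset_iff_subset_inv_smul_set] at hst
        exact hst
      have h2 := hrec _ c hc h1
      rw [mul_smul] at h2
      rw [eq_inv_smul_iff] at h2
      exact h2
  have hOf : ∀ c ∈ W, (MulAction.orbit G c).Finite := by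
    intro c hc
    by_contra hinf
    obtain ⟨S, hS, hcard⟩ := Set.Infinite.exists_subset_card_eq hinf (M + 1)
    have := hO c hc S (fun s hs => hS hs)
    omega
  by_contra hinf
  obtain ⟨Y, hY, hYc⟩ := Set.Infinite.exists_subset_card_eq hinf (2 ^ (M * M) + 1)
  have hs' : ∀ p : X × X, ∃ c : Set X, p.1 ∈ Y → p.2 ∈ Y → p.1 ≠ p.2 →
      c ∈ W ∧ p.1 ∈ c ∧ p.2 ∉ c := by
    rintro ⟨y, z⟩
    by_cases h : y ∈ Y ∧ z ∈ Y ∧ y ≠ z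
    · obtain ⟨c, h1, h2⟩ := hsep y (hY h.1) z (hY h.2.1) h.2.2
      exact ⟨c, fun _ _ _ => ⟨h1, h2⟩⟩
    · exact ⟨∅, fun h1 h2 h3 => absurd ⟨h1, h2, h3⟩ h⟩
  choose s hs using hs'
  let F0 : Set (Set X) := (s '' (↑(Y ×ˢ Y) : Set (X × X))) ∩ W
  have hF0 : F0.Finite := ((Finset.finite_toSet _).image s).subset Set.inter_subset_left
  let F : Set (Set X) := ⋃ c ∈ F0, MulAction.orbit G c
  have hF : F.Finite := hF0.biUnion (fun c hc => hOf c hc.2)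
  have hFW : ∀ c ∈ F, c ∈ W := by
    intro c hc
    simp only [F, Set.mem_iUnion] at hc
    obtain ⟨d, hd, g, rfl⟩ := hc
    exact hinv g d hd.2
  have hFinv : ∀ (g : G), ∀ c ∈ F, g • c ∈ F := by
    intro g c hc
    simp only [F, Set.mem_iUnion] at hc ⊢
    obtain ⟨d, hd, a, rfl⟩ := hc
    exact ⟨d, hd, g * a, mul_smul g a d⟩
  let A : X → Finset (Set X) := fun y =>
    hF.toFinset.filter (fun c => y ∈ c ∧ ∀ d ∈ F, y ∈ d → d ⊆ c → d = c)
  have hA : ∀ y c, c ∈ A y ↔ c ∈ F ∧ y ∈ c ∧ ∀ d ∈ F, y ∈ d → d ⊆ c → d = c := by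
    intro y c
    simp [A]
  have hAc : ∀ y, (A y).card ≤ M := by
    intro y
    refine hanti _ (fun c hc => hFW c ((hA _ _).1 hc).1) (fun c hc d hd hcd => ?_)
    rw [hA] at hc hd
    exact hd.2.2 c hc.1 hc.2.1 hcd
  have hOt : ∀ c, ∃ S : Finset (Set X), c ∈ W → ∀ d, d ∈ S ↔ d ∈ MulAction.orbit G c := by
    intro c
    by_cases hc : c ∈ W
    · exact ⟨(hOf c hc).toFinset, fun _ d => by simp⟩
    · exact ⟨∅, fun h => absurd h hc⟩
  choose O hOm using hOt
  let T : Finset (Set X) := (A x).biUnion O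
  have hT : T.card ≤ M * M := by
    refine (Finset.card_biUnion_le_card_mul _ _ M (fun c hc => ?_)).trans
      (Nat.mul_le_mul_right _ (hAc x))
    have hcW := hFW c ((hA _ _).1 hc).1
    exact hO c hcW _ (fun d hd => (hOm c hcW d).1 hd)
  have hAT : ∀ y ∈ Y, A y ∈ T.powerset := by
    intro y hy
    rw [Finset.mem_powerset]
    intro c hc
    obtain ⟨g, rfl⟩ := hY hy
    rw [hA] at hc
    have hc2 : g • x ∈ c := hc.2.1
    have key : g⁻¹ • c ∈ A x := by
      rw [hA]
      refine ⟨hFinv _ _ hc.1, ?_, ?_⟩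
      · rw [Set.mem_inv_smul_set_iff]; exact hc2
      · intro d hd hxd hdc
        have := hc.2.2 (g • d) (hFinv g d hd) (Set.smul_mem_smul_set hxd)
          (by rw [Set.smul_set_subset_iff_subset_inv_smul_set]; exact hdc)
        rw [← this, inv_smul_smul]
    refine Finset.mem_biUnion.2 ⟨_, key, ?_⟩
    rw [hOm _ (hFW _ ((hA _ _).1 key).1)]
    exact ⟨g, by simp⟩
  have hinj : Set.InjOn A Y := by
    intro y hy z hz hyz
    by_contra hne
    obtain ⟨h1, h2, h3⟩ := hs (y, z) hy hz hne
    have hcF : s (y, z) ∈ F := by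
      simp only [F, Set.mem_iUnion]
      refine ⟨s (y, z), ⟨⟨(y, z), ?_, rfl⟩, h1⟩, MulAction.mem_orbit_self _⟩
      simp only [Finset.coe_product, Set.mem_prod]
      exact ⟨hy, hz⟩
    let B : Set (Set X) := {d | d ∈ F ∧ y ∈ d ∧ d ⊆ s (y, z)}
    have hB : B.Finite := hF.subset (fun d hd => hd.1)
    obtain ⟨c, hc⟩ := hB.exists_minimal ⟨s (y, z), hcF, h2, subset_rfl⟩
    have hcA : c ∈ A y := by
      rw [hA]
      refine ⟨hc.1.1, hc.1.2.1, fun d hd hyd hdc => ?_⟩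
      exact subset_antisymm hdc (hc.2 ⟨hd, hyd, hdc.trans hc.1.2.2⟩ hdc)
    rw [hyz, hA] at hcA
    exact h3 (hc.1.2.2 hcA.2.1)
  have h1 := Finset.card_le_card_of_injOn A hAT hinj
  rw [Finset.card_powerset] at h1
  have h2 : 2 ^ T.card ≤ 2 ^ (M * M) := Nat.pow_le_pow_right (by norm_num) hT
  omega

end Comb

section Final
open Pointwise

/-- The stabilizer of a point in the isometry group. -/
def isoStab {X : Type*} [MetricSpace X] (x₀ : X) : Subgroup (X ≃ᵢ X) where
  carrier := {g | g x₀ = x₀}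
  mul_mem' := by
    intro a b ha hb
    change a (b x₀) = x₀
    rw [show b x₀ = x₀ from hb]; exact ha
  one_mem' := rfl
  inv_mem' := by
    intro a ha
    change a⁻¹ x₀ = x₀
    conv_lhs => rw [← show a x₀ = x₀ from ha]
    exact IsometryEquiv.inv_apply_self a x₀

instance isoStabAction {X : Type*} [MetricSpace X] (x₀ : X) : MulAction (isoStab x₀) X where
  smul g y := (g : X ≃ᵢ X) y
  one_smul _ := rfl
  mul_smul _ _ _ := rfl

lemma stab_dist {X : Type*} [MetricSpace X] {x₀ : X} (g : isoStab x₀) (y z : X) :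
    dist (g • y) (g • z) = dist y z := (g : X ≃ᵢ X).isometry.dist_eq y z

lemma stab_fix {X : Type*} [MetricSpace X] {x₀ : X} (g : isoStab x₀) : g • x₀ = x₀ := g.2

lemma stab_dist0 {X : Type*} [MetricSpace X] {x₀ : X} (g : isoStab x₀) (p : X) :
    dist (g • p) x₀ = dist p x₀ := by
  have := stab_dist g p x₀
  rwa [stab_fix] at this

lemma stab_isom {X : Type*} [MetricSpace X] {x₀ : X} (g : isoStab x₀) :
    Isometry (fun y : X => g • y) := (g : X ≃ᵢ X).isometry

lemma smul_halfspace {X : Type*} [MetricSpace X] {x₀ : X} (g : isoStab x₀) {h : Set X}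
    (hh : IsHalfspace h) : IsHalfspace (g • h) := by
  rw [← Set.preimage_smul_inv]
  exact preimage_halfspace (stab_isom g⁻¹) hh

instance isoStabCont {X : Type*} [MetricSpace X] (x₀ : X) :
    ContinuousConstSMul (isoStab x₀) X := ⟨fun g => (stab_isom g).continuous⟩

/-- Recurrence. -/
lemma stab_rec {X : Type*} [MetricSpace X] [ProperSpace X] {x₀ : X} (g : isoStab x₀) {c : Set X}
    (hc : IsClosed c) (hcg : c ⊆ g • c) : c = g • c := by
  refine subset_antisymm hcg (fun p hp => ?_)
  have hmono : ∀ k : ℕ, c ⊆ g ^ k • c := by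
    intro k
    induction k with
    | zero => simp
    | succ k ih =>
      rw [pow_succ', mul_smul]
      exact hcg.trans (Set.smul_set_mono ih)
  rw [← hc.closure_eq, Metric.mem_closure_iff]
  intro ε hε
  have hin : ∀ i : ℕ, g ^ i • p ∈ Metric.closedBall x₀ (dist p x₀) := by
    intro i
    rw [Metric.mem_closedBall, stab_dist0]
  obtain ⟨a, _, φ, hφ, hlim⟩ := (isCompact_closedBall x₀ (dist p x₀)).tendsto_subseq hin
  obtain ⟨N, hN⟩ := Metric.cauchySeq_iff.1 hlim.cauchySeq ε hε
  have hlt : φ N < φ (N + 1) := hφ (Nat.lt_succ_self N)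
  have hd := hN N le_rfl (N + 1) (Nat.le_succ N)
  simp only [Function.comp] at hd
  obtain ⟨k, hk⟩ : ∃ k, φ (N + 1) = φ N + (k + 1) := ⟨φ (N + 1) - φ N - 1, by omega⟩
  rw [hk, pow_add, mul_smul, stab_dist] at hd
  refine ⟨(g ^ (k + 1))⁻¹ • p, ?_, ?_⟩
  · rw [← Set.mem_smul_set_iff_inv_smul_mem]
    rw [pow_succ', mul_smul]
    exact Set.smul_set_mono (hmono k) hp
  · have := stab_dist (g ^ (k + 1)) p ((g ^ (k + 1))⁻¹ • p)
    rw [smul_inv_smul] at this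
    rw [← this, dist_comm]
    exact hd

end Final
section Final2
open Pointwise

lemma stab_orbit_finite {X : Type*} [MetricSpace X] [CompleteSpace X] [ConnectedSpace X]
    [LocallyCompactSpace X] (hmed : IsMedianSpace X) {n : ℕ} (hn : RankLE X n)
    (hmin : ∀ x : X, mConvexHull
      {y : X | ∃ f : X → X, Isometry f ∧ Function.Surjective f ∧ f x = y} = Set.univ)
    (x₀ x : X) : (MulAction.orbit (isoStab x₀) x).Finite := by
  classical
  haveI := median_proper hmed
  obtain ⟨ε, hε, R, hdepth⟩ := uniform_depth hn
    (fun h hh hne => no_thin hmed hn hmin hh hne) x₀ x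
  obtain ⟨P, -, hPf, hPc⟩ := (isCompact_closedBall x₀ R).finite_cover_balls hε
  let W : Set (Set X) := {c | ∃ h, IsHalfspace h ∧ c = closure h ∧ x₀ ∉ h ∧
    ∃ k : isoStab x₀, k • x ∈ h}
  refine comb (G := isoStab x₀) W (hPf.toFinset.card * n) x ?_ ?_ ?_ ?_
  · rintro g c ⟨h, hh, rfl, h0, k, hk⟩
    refine ⟨g • h, smul_halfspace g hh, (closure_smul g h).symm, ?_, g * k, ?_⟩
    · intro hx
      rw [Set.mem_smul_set_iff_inv_smul_mem, stab_fix] at hx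
      exact h0 hx
    · rw [mul_smul]
      exact Set.smul_mem_smul_set hk
  · intro A hAW hA
    by_contra hlt
    push Not at hlt
    have hch : ∀ c : Set X, ∃ h : Set X, ∃ q : X, c ∈ A →
        IsHalfspace h ∧ c = closure h ∧ x₀ ∉ h ∧ q ∈ h ∧ q ∈ P := by
      intro c
      by_cases hc : c ∈ A
      · obtain ⟨h, hh, hcl, h0, k, hk⟩ := hAW c hc
        obtain ⟨p, hp1, hp2⟩ := hdepth (k⁻¹ • h) (smul_halfspace _ hh)
          (by rw [Set.mem_inv_smul_set_iff]; exact hk)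
          (by rw [Set.mem_inv_smul_set_iff, stab_fix]; exact h0)
        have hkp : k • p ∈ Metric.closedBall x₀ R := by
          rw [Metric.mem_closedBall, stab_dist0]; exact hp2
        have := hPc hkp
        simp only [Set.mem_iUnion] at this
        obtain ⟨q, hqP, hq⟩ := this
        refine ⟨h, q, fun _ => ⟨hh, hcl, h0, ?_, hqP⟩⟩
        have h1 : k⁻¹ • q ∈ k⁻¹ • h := by
          apply hp1
          rw [Metric.mem_ball, ← stab_dist k, smul_inv_smul, dist_comm]
          exact hq
        exact Set.smul_mem_smul_set_iff.1 h1
      · exact ⟨∅, x₀, fun h => absurd h hc⟩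
    choose H Q hHQ using hch
    obtain ⟨q, hq, hcard⟩ := Finset.exists_lt_card_fiber_of_mul_lt_card_of_maps_to
      (s := A) (t := hPf.toFinset) (f := Q) (n := n)
      (fun c hc => by simpa using (hHQ c hc).2.2.2.2) hlt
    obtain ⟨S, hS, hSc⟩ := Finset.exists_subset_card_eq (show n + 1 ≤ _ from hcard)
    let e := (S.equivFinOfCardEq hSc).symm
    have hmem : ∀ i, ((e i : S) : Set X) ∈ A ∧ Q (e i) = q := fun i =>
      Finset.mem_filter.1 (hS (e i).2)
    refine hn ⟨fun i => H (e i), fun i => (hHQ _ (hmem i).1).1, fun i j hij => ?_⟩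
    have Hi := hHQ _ (hmem i).1
    have Hj := hHQ _ (hmem j).1
    have hne : ((e i : S) : Set X) ≠ (e j : S) := fun h => hij (e.injective (Subtype.ext h))
    refine transverse_of_incomparable (p := q) (q := x₀) ?_ ?_ Hi.2.2.1 Hj.2.2.1 ?_ ?_
    · have := Hi.2.2.2.1; rwa [(hmem i).2] at this
    · have := Hj.2.2.2.1; rwa [(hmem j).2] at this
    · intro hsub
      exact hne (hA _ (hmem i).1 _ (hmem j).1 (by
        rw [Hi.2.1, Hj.2.1]; exact closure_mono hsub))
    · intro hsub
      exact hne (hA _ (hmem j).1 _ (hmem i).1 (by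
        rw [Hi.2.1, Hj.2.1]; exact closure_mono hsub)).symm
  · rintro g c ⟨h, hh, rfl, -⟩ hcg
    exact stab_rec g isClosed_closure hcg
  · rintro y ⟨a, ha⟩ z ⟨b, hb⟩ hyz
    change a • x = y at ha
    change b • x = z at hb
    have hd : dist y x₀ = dist z x₀ := by rw [← ha, ← hb, stab_dist0, stab_dist0]
    set m := med hmed x₀ y z with hm
    have m1 : m ∈ mInterval x₀ y := med_ab hmed x₀ y z
    have m2 : m ∈ mInterval y z := med_bc hmed x₀ y z
    have m3 : m ∈ mInterval x₀ z := med_ac hmed x₀ y z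
    have hmy : y ≠ m := by
      intro h
      rw [← h] at m3
      have h3 : dist x₀ y + dist y z = dist x₀ z := m3
      rw [dist_comm x₀ y, dist_comm x₀ z] at h3
      exact hyz (dist_eq_zero.1 (by linarith))
    obtain ⟨η, hη, hsep⟩ := thick_sep hmed hn (dist_pos.2 hmy)
    obtain ⟨h, hh, h1, h2⟩ := hsep {y} {m} (singleton_convex y) (singleton_convex m)
      (Set.singleton_nonempty _) (Set.singleton_nonempty _) (by
        rintro a rfl b rfl; exact le_rfl)
    have hy : y ∈ h := h1 y rfl (Metric.mem_ball_self hη)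
    have hmh : m ∉ closure h := by
      intro hmc
      obtain ⟨w, hw, hwd⟩ := Metric.mem_closure_iff.1 hmc η hη
      exact h2 m rfl (by rw [Metric.mem_ball, dist_comm]; exact hwd) hw
    refine ⟨closure h, ⟨h, hh, rfl, ?_, a, by rw [ha]; exact hy⟩, subset_closure hy, ?_⟩
    · intro h0
      exact hmh (subset_closure (hh.1 _ h0 _ hy m1))
    · intro hz
      exact hmh (closure_convex hmed hh.1 _ (subset_closure hy) _ hz m2)

end Final2

/-- In a complete connected locally compact median space of finite rank on which the
isometry group acts minimally, every orbit of the stabilizer of a point is finite. -/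
theorem statement17 (X : Type*) [MetricSpace X] [CompleteSpace X] [ConnectedSpace X]
    [LocallyCompactSpace X] (hmed : IsMedianSpace X) (hrank : ∃ n : ℕ, HasMedianRank X n)
    (hmin : ∀ x : X, mConvexHull
      {y : X | ∃ f : X → X, Isometry f ∧ Function.Surjective f ∧ f x = y} = Set.univ)
    (x₀ x : X) :
    Set.Finite {y : X | ∃ f : X → X, Isometry f ∧ Function.Surjective f ∧
      f x₀ = x₀ ∧ f x = y} := by
  obtain ⟨n, -, hn⟩ := hrank
  refine (stab_orbit_finite hmed (n := n) hn hmin x₀ x).subset ?_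
  rintro y ⟨f, hf, hfs, h0, rfl⟩
  exact ⟨⟨IsometryEquiv.mk' f (Function.surjInv hfs) (Function.surjInv_eq hfs) hf, h0⟩, rfl⟩
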